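/- Fix n ≥ 1 and r ≥ 0. Let (a_j)_{j ∈ ℤ} be matrices in Matrix (Fin n) (Fin n) ℂ with a_j = 0 unless -r(n-1) ≤ j ≤ r, and suppose that the matrix f(z) := ∑_j a_j z^j is unitary for every z ∈ ℂ with ‖z‖ = 1. Then the closed subspace W_f := closure(M_f(K₊)) satisfies K_r ⊆ W_f ⊆ K_{-r(n-1)}. -/

import Mathlib

noncomputable section

/-- The Hilbert space `K = ℓ²(ℤ, ℂⁿ)`, the model of `L²(S¹) ⊗ ℂⁿ`. -/
abbrev KSpN (n : ℕ) := lp (fun _ : ℤ => EuclideanSpace ℂ (Fin n)) 2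

theorem avg (m : ℤ) : ∫ t in (0:ℝ)..(2*Real.pi), (Complex.exp (t * Complex.I)) ^ m = if m = 0 then (2*Real.pi:ℂ) else 0 := by
  split_ifs with h
  · simp [h]
  · have h2 : ∀ t : ℝ, (Complex.exp (t * Complex.I)) ^ m = Complex.exp ((m * Complex.I) * t) := by
      intro t; rw [← Complex.exp_int_mul]; congr 1; ring
    simp_rw [h2]
    rw [integral_exp_mul_complex (by simp [h])]
    have : Complex.exp ((m * Complex.I) * ((2 * Real.pi : ℝ) : ℂ)) = 1 := by
      rw [← Complex.exp_int_mul_two_pi_mul_I m]; congr 1; push_cast; ring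
    rw [this]; simp

theorem coeffs {n : ℕ} (a : ℤ → Matrix (Fin n) (Fin n) ℂ) (S : Finset ℤ)
    (hu : ∀ z : ℂ, ‖z‖ = 1 → (∑ j ∈ S, z ^ j • a j) ∈ Matrix.unitaryGroup (Fin n) ℂ) (k : ℤ) :
    ∑ j ∈ S, ∑ l ∈ S, (if j - l = k then a j * (a l).conjTranspose else 0) = if k = 0 then 1 else 0 := by
  have h1 : ∀ z : ℂ, ‖z‖ = 1 → ∀ p q, ∑ j ∈ S, ∑ l ∈ S, z ^ (j - l - k) * (a j * (a l).conjTranspose) p q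
      = z ^ (-k) * (1 : Matrix (Fin n) (Fin n) ℂ) p q := by
    intro z hz p q
    have hz0 : z ≠ 0 := by rintro rfl; simp at hz
    have := Matrix.mem_unitaryGroup_iff.1 (hu z hz)
    rw [← this, Matrix.star_eq_conjTranspose, Matrix.conjTranspose_sum, Finset.sum_mul_sum, Matrix.sum_apply,
      Finset.mul_sum]
    refine Finset.sum_congr rfl fun j _ => ?_
    rw [Matrix.sum_apply, Finset.mul_sum]
    refine Finset.sum_congr rfl fun l _ => ?_
    have hc : star z = z⁻¹ := by
      rw [Complex.inv_def, Complex.normSq_eq_norm_sq, hz]; simp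
    rw [Matrix.conjTranspose_smul, star_zpow₀, hc, Matrix.smul_mul, Matrix.mul_smul, Matrix.smul_apply, Matrix.smul_apply,
      smul_eq_mul, smul_eq_mul, sub_eq_add_neg (j-l), zpow_add₀ hz0, sub_eq_add_neg, zpow_add₀ hz0, inv_zpow', ]
    ring
  have hcont : ∀ m : ℤ, Continuous fun t : ℝ => (Complex.exp (t * Complex.I)) ^ m := fun m =>
    Continuous.zpow₀ (by fun_prop) m (fun t => Or.inl (Complex.exp_ne_zero _))
  have hpi : (2 * Real.pi : ℂ) ≠ 0 := by simp [Real.pi_ne_zero]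
  ext p q
  have h2 : ∫ t in (0:ℝ)..(2*Real.pi), ∑ j ∈ S, ∑ l ∈ S, (Complex.exp (t * Complex.I)) ^ (j - l - k) * (a j * (a l).conjTranspose) p q
     = ∫ t in (0:ℝ)..(2*Real.pi), (Complex.exp (t * Complex.I)) ^ (-k) * (1 : Matrix (Fin n) (Fin n) ℂ) p q := by
    congr 1; ext t
    exact h1 _ (Complex.norm_exp_ofReal_mul_I t) p q
  rw [intervalIntegral.integral_finsetSum, intervalIntegral.integral_mul_const, avg] at h2
  · apply mul_left_cancel₀ hpi
    rw [Matrix.sum_apply, Finset.mul_sum]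
    trans (if -k = 0 then (2 * Real.pi : ℂ) else 0) * (1 : Matrix (Fin n) (Fin n) ℂ) p q
    · rw [← h2]
      refine Finset.sum_congr rfl fun j _ => ?_
      rw [intervalIntegral.integral_finsetSum, Matrix.sum_apply, Finset.mul_sum]
      · refine Finset.sum_congr rfl fun l _ => ?_
        rw [intervalIntegral.integral_mul_const, avg]
        by_cases h : j - l = k
        · simp [h]
        · simp [h, sub_eq_zero]
      · intro l _
        exact ((hcont _).mul continuous_const).intervalIntegrable _ _
    · by_cases h : k = 0 <;> simp [h]
  · intro j _
    exact (continuous_finsetSum _ fun l _ => (hcont _).mul continuous_const).intervalIntegrable _ _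

theorem memlp_shift {n : ℕ} (A : Matrix (Fin n) (Fin n) ℂ) (y : KSpN n) (l : ℤ) :
    Memℓp (fun m : ℤ => Matrix.toEuclideanCLM (n := Fin n) (𝕜 := ℂ) A (y (m + l))) 2 := by
  have h := lp.memℓp y
  rw [memℓp_gen_iff (by norm_num)] at h ⊢
  have h' := (h.comp_injective (add_left_injective l)).mul_left
    (‖Matrix.toEuclideanCLM (n := Fin n) (𝕜 := ℂ) A‖ ^ (2 : ENNReal).toReal)
  refine Summable.of_nonneg_of_le (fun m => by positivity) (fun m => ?_) h'
  simp only [Function.comp]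
  rw [← Real.mul_rpow (norm_nonneg _) (norm_nonneg _)]
  exact Real.rpow_le_rpow (norm_nonneg _) (ContinuousLinearMap.le_opNorm _ _) (by norm_num)

theorem conv_inverse {n : ℕ} (a : ℤ → Matrix (Fin n) (Fin n) ℂ) (S : Finset ℤ)
    (hu : ∀ z : ℂ, ‖z‖ = 1 → (∑ j ∈ S, z ^ j • a j) ∈ Matrix.unitaryGroup (Fin n) ℂ)
    (y : ℤ → EuclideanSpace ℂ (Fin n)) (m : ℤ) :
    ∑ j ∈ S, Matrix.toEuclideanCLM (n := Fin n) (𝕜 := ℂ) (a j)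
      (∑ l ∈ S, Matrix.toEuclideanCLM (n := Fin n) (𝕜 := ℂ) (a l).conjTranspose (y (m - j + l)))
      = y m := by
  classical
  set T : Finset ℤ := insert 0 (Finset.image (fun p : ℤ × ℤ => p.1 - p.2) (S ×ˢ S)) with hT
  have key : ∑ k ∈ T, Matrix.toEuclideanCLM (n := Fin n) (𝕜 := ℂ)
      (∑ j ∈ S, ∑ l ∈ S, (if j - l = k then a j * (a l).conjTranspose else 0)) (y (m - k))
      = y m := by
    simp_rw [coeffs a S hu]
    rw [Finset.sum_eq_single 0]
    · simp
    · intro k _ hk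
      simp [hk]
    · intro h
      exact absurd (Finset.mem_insert_self _ _) h
  rw [← key]
  symm
  simp only [map_sum, ContinuousLinearMap.sum_apply]
  rw [Finset.sum_comm]
  refine Finset.sum_congr rfl fun j hj => ?_
  rw [Finset.sum_comm]
  refine Finset.sum_congr rfl fun l hl => ?_
  rw [Finset.sum_eq_single (j - l)]
  · rw [if_pos rfl, map_mul, ContinuousLinearMap.mul_apply, show m - (j - l) = m - j + l by ring]
  · intro k _ hk
    rw [if_neg (Ne.symm hk)]
    simp
  · intro h
    exact absurd (Finset.mem_insert_of_mem (Finset.mem_image.2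
      ⟨(j, l), Finset.mem_product.2 ⟨hj, hl⟩, rfl⟩)) h

/-- Let `f(z) = ∑_{j=-r(n-1)}^{r} a_j z^j` be a matrix Laurent polynomial
which is unitary on the unit circle, and let `M_f` be the corresponding multiplication
operator on `K = ℓ²(ℤ, ℂⁿ)`, `(M_f x)(m) = ∑_j a_j (x (m - j))`.  Then the closed subspace
`W_f = closure (M_f K₊)` satisfies `K_r ⊆ W_f ⊆ K_{-r(n-1)}`. -/
theorem Wf_mem_bounded_grassmannian
    (n : ℕ) (hn : 1 ≤ n) (r : ℕ)
    (a : ℤ → Matrix (Fin n) (Fin n) ℂ)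
    (hsupp : ∀ j : ℤ, a j ≠ 0 → (-(r : ℤ) * ((n : ℤ) - 1) ≤ j ∧ j ≤ (r : ℤ)))
    (hunitary : ∀ z : ℂ, ‖z‖ = 1 →
      (∑ j ∈ Finset.Icc (-(r : ℤ) * ((n : ℤ) - 1)) (r : ℤ), z ^ j • a j)
        ∈ Matrix.unitaryGroup (Fin n) ℂ)
    (Mf : KSpN n → KSpN n)
    (hMf : ∀ (x : KSpN n) (m : ℤ), Mf x m =
      ∑ j ∈ Finset.Icc (-(r : ℤ) * ((n : ℤ) - 1)) (r : ℤ), (a j).mulVec (x (m - j))) :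
    {x : KSpN n | ∀ m : ℤ, m < (r : ℤ) → x m = 0}
        ⊆ closure (Mf '' {x : KSpN n | ∀ m : ℤ, m < 0 → x m = 0}) ∧
      closure (Mf '' {x : KSpN n | ∀ m : ℤ, m < 0 → x m = 0})
        ⊆ {x : KSpN n | ∀ m : ℤ, m < -(r : ℤ) * ((n : ℤ) - 1) → x m = 0} := by
  have hL : ∀ (x : KSpN n) (m : ℤ), Mf x m =
      ∑ j ∈ Finset.Icc (-(r : ℤ) * ((n : ℤ) - 1)) (r : ℤ),
        Matrix.toEuclideanCLM (n := Fin n) (𝕜 := ℂ) (a j) (x (m - j)) := by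
    intro x m
    ext i
    rw [hMf]
    simp
  clear hMf
  generalize hS : Finset.Icc (-(r : ℤ) * ((n : ℤ) - 1)) (r : ℤ) = S at *
  have hSm : ∀ j ∈ S, -(r : ℤ) * ((n : ℤ) - 1) ≤ j ∧ j ≤ (r : ℤ) := by
    intro j hj
    rw [← hS] at hj
    exact Finset.mem_Icc.1 hj
  constructor
  · intro y hy
    apply subset_closure
    have hmem : Memℓp (fun m : ℤ => ∑ l ∈ S,
        Matrix.toEuclideanCLM (n := Fin n) (𝕜 := ℂ) (a l).conjTranspose (y (m + l))) 2 :=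
      Memℓp.finsetSum S fun l _ => memlp_shift _ y l
    refine ⟨⟨_, hmem⟩, ?_, ?_⟩
    · intro m hm
      refine Finset.sum_eq_zero fun l hl => ?_
      rw [hy (m + l) (by have := (hSm l hl).2; omega), map_zero]
    · ext1
      funext m
      rw [hL]
      exact conv_inverse a S hunitary y m
  · have hcl : IsClosed {x : KSpN n | ∀ m : ℤ, m < -(r : ℤ) * ((n : ℤ) - 1) → x m = 0} := by
      simp only [Set.setOf_forall]
      refine isClosed_iInter fun m => isClosed_iInter fun _ => ?_
      exact isClosed_eq
        (lp.evalCLM ℂ (fun _ : ℤ => EuclideanSpace ℂ (Fin n)) 2 m).continuous continuous_const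
    refine closure_minimal ?_ hcl
    rintro _ ⟨x, hx, rfl⟩ m hm
    rw [hL]
    refine Finset.sum_eq_zero fun j hj => ?_
    rw [hx (m - j) (by have := (hSm j hj).1; omega), map_zero]

end
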